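/- arXiv:math/0409158 — 5 statements merged into one kernel-verified Lean document; each statement's English description precedes it below -/
import Mathlib

section
/- Let f : B → A be a function between types and let γ : P_f X → X be an injective function (a prefixed point of the polynomial functor P_f, i.e. a P_f-algebra whose structure map is monic). Then (X, γ) has a subalgebra that is a fixed point: there exist a type Y, an injective function i : Y → X, and a bijection e : P_f Y ≃ Y such that i ∘ e = γ ∘ P_f(i). -/
inductive GoodPt {B A X : Type} (f : B → A)
    (γ : (Σ a : A, {b : B // f b = a} → X) → X) : X → Prop
  | mk (a : A) (t : {b : B // f b = a} → X) (h : ∀ b, GoodPt f γ (t b)) : GoodPt f γ (γ ⟨a, t⟩)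

/-- A prefixed point of the polynomial functor `P_f` (an algebra
`γ : P_f X → X` with `γ` injective) has a subalgebra that is a fixed point:
there are a type `Y`, an injection `i : Y → X` and a bijection `e : P_f Y ≃ Y`
with `i ∘ e = γ ∘ P_f i`. -/
theorem prefixed_point_has_fixed_subalgebra {B A X : Type} (f : B → A)
    (γ : (Σ a : A, {b : B // f b = a} → X) → X) (hγ : Function.Injective γ) :
    ∃ (Y : Type) (i : Y → X) (e : (Σ a : A, {b : B // f b = a} → Y) ≃ Y),
      Function.Injective i ∧
      ∀ p : Σ a : A, {b : B // f b = a} → Y,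
        i (e p) = γ ⟨p.1, fun b => i (p.2 b)⟩ := by
  let e : (Σ a : A, {b : B // f b = a} → {x // GoodPt f γ x}) → {x // GoodPt f γ x} :=
    fun p => ⟨γ ⟨p.1, fun b => (p.2 b).1⟩, GoodPt.mk p.1 _ fun b => (p.2 b).2⟩
  have he : Function.Bijective e := by
    constructor
    · rintro ⟨a, t⟩ ⟨a', t'⟩ h
      have h1 := hγ (congrArg Subtype.val h)
      obtain ⟨h2, h3⟩ := Sigma.mk.inj h1
      dsimp only at h2
      subst h2
      have h4 := eq_of_heq h3
      have h5 : t = t' := funext fun b => Subtype.ext (congrFun h4 b)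
      rw [h5]
    · rintro ⟨x, hx⟩
      cases hx with
      | mk a t h => exact ⟨⟨a, fun b => ⟨t b, h b⟩⟩, rfl⟩
  exact ⟨{x // GoodPt f γ x}, Subtype.val, Equiv.ofBijective e he,
    Subtype.val_injective, fun p => rfl⟩
end

section
/- Let f : B → A be a function between types where A has decidable equality. Let S be the type of alternating finite sequences ⟨a₀, b₀, a₁, b₁, …, a_n⟩ (n ≥ 0) with a_i : A, b_i : B and f(b_i) = a_i for all i < n, and let V = S → Bool. Define m : P_f V → V by: m(a, t)(⟨a₀⟩) = true iff a₀ = a, and m(a, t)(⟨a₀, b₀⟩ * σ) = true iff a₀ = a and t(b₀)(σ) = true (where, when a₀ = a, the condition f(b₀) = a₀ makes b₀ an element of f⁻¹(a), and * denotes concatenation). Then m is well defined and injective; hence (V, m) is a prefixed point of the polynomial functor P_f. -/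
/-- The type `S` of alternating finite sequences `⟨a₀, b₀, a₁, b₁, …, aₙ⟩` with
`f bᵢ = aᵢ` for all `i < n`: either a single `⟨a⟩`, or `⟨a, b⟩ * σ` with `f b = a`. -/
inductive AltSeq {B A : Type} (f : B → A) : Type
  | single (a : A) : AltSeq f
  | cons (a : A) (b : B) (h : f b = a) (σ : AltSeq f) : AltSeq f

/-- The map `m : P_f V → V`, where `V = S → Bool`, sending `(a, t)` to the decidable
subobject `P` of `S` with `⟨a₀⟩ ∈ P` iff `a₀ = a`, and `⟨a₀, b₀⟩ * σ ∈ P` iff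
`a₀ = a` and `σ ∈ t b₀` (where the conditions `f b₀ = a₀` and `a₀ = a` exhibit `b₀`
as an element of `f⁻¹(a)`). -/
def mPre {B A : Type} [DecidableEq A] (f : B → A)
    (p : Σ a : A, {b : B // f b = a} → (AltSeq f → Bool)) : AltSeq f → Bool
  | AltSeq.single a₀ => decide (a₀ = p.1)
  | AltSeq.cons a₀ b₀ h σ =>
      if h' : a₀ = p.1 then p.2 ⟨b₀, h.trans h'⟩ σ else false

/-- If `A` has decidable equality, then `m : P_f V → V` is injective; hence
`(V, m)` is a prefixed point of the polynomial functor `P_f`. -/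
theorem mPre_injective {B A : Type} [DecidableEq A] (f : B → A) :
    Function.Injective (mPre f) := by
  rintro ⟨a, t⟩ ⟨a', t'⟩ h
  have h1 : a = a' := by
    have := congrFun h (AltSeq.single a)
    simpa [mPre] using this
  subst h1
  have h2 : t = t' := by
    funext b σ
    have := congrFun h (AltSeq.cons a b.1 b.2 σ)
    simpa [mPre] using this
  rw [h2]
end

section
/- Let f : B → A and α : A → I be functions between types, and let (M_f, τ_f) be a terminal P_f-coalgebra in Type (for instance Mathlib's PFunctor.M). For each i : I, let M^I(i) be the largest subset of M_f with the property that every T ∈ M^I(i) satisfies: τ_f(T) = (a, t) with α(a) = i and t(b) ∈ M^I(i) for all b ∈ f⁻¹(a) (i.e. the union of all families of subsets closed under this condition). Then the I-indexed family i ↦ M^I(i), with structure maps induced by τ_f, is a terminal object in the category of P^I-coalgebras; that is, it is the M-type of f in the slice over I. -/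
open CategoryTheory

section

variable {B A I : Type} (f : B → A) (α : A → I)

/-- A coalgebra for the indexed polynomial functor `P^I` determined by `f : B → A` and
`α : A → I`: a family `X : I → Type` with maps
`γ i : X i → Σ (a : {a // α a = i}), (f⁻¹(a) → X i)`. -/
structure ICoalg where
  X : I → Type
  str : ∀ i : I, X i → Σ a : {a : A // α a = i}, ({b : B // f b = a.1} → X i)

/-- A morphism of `P^I`-coalgebras: a family of maps commuting with the structure maps. -/
@[ext]
structure ICoalg.Hom (P Q : ICoalg f α) where
  φ : ∀ i, P.X i → Q.X i
  comm : ∀ i x, Q.str i (φ i x) = ⟨(P.str i x).1, fun b => φ i ((P.str i x).2 b)⟩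

instance : Category (ICoalg f α) where
  Hom P Q := ICoalg.Hom f α P Q
  id P := ⟨fun _ => id, fun i x => rfl⟩
  comp {P Q R} g h :=
    ⟨fun i => h.φ i ∘ g.φ i, fun i x => by
      show R.str i (h.φ i (g.φ i x)) = _
      rw [h.comm i (g.φ i x), g.comm i x]
      rfl⟩
  id_comp g := ICoalg.Hom.ext rfl
  comp_id g := ICoalg.Hom.ext rfl
  assoc g h i := ICoalg.Hom.ext rfl

/-- The polynomial functor of `f` as a `PFunctor`, whose `M`-type is Mathlib's
`PFunctor.M`, a terminal `P_f`-coalgebra. -/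
def PolyPF : PFunctor := ⟨A, fun a => {b : B // f b = a}⟩

/-- `C ⊆ M_f` is closed under the slice condition at `i : I` if every `T ∈ C` has root
labelled by some `a` with `α a = i` and all children again in `C`. -/
def HeredI (i : I) (C : Set (PolyPF f).M) : Prop :=
  ∀ T ∈ C, α (PFunctor.M.dest T).1 = i ∧ ∀ b, (PFunctor.M.dest T).2 b ∈ C

/-- `M^I i`, the largest subset of `M_f` all of whose members have all labels in the
fibre of `α` over `i`. -/
def MI (i : I) : Set (PolyPF f).M :=
  {T | ∃ C : Set (PolyPF f).M, HeredI f α i C ∧ T ∈ C}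

theorem MI_hered (i : I) : HeredI f α i (MI f α i) := by
  rintro T ⟨C, hC, hT⟩
  exact ⟨(hC T hT).1, fun b => ⟨C, hC, (hC T hT).2 b⟩⟩

/-- The structure map on `MI`. -/
def MIstr (i : I) (T : ↥(MI f α i)) :
    Σ a : {a : A // α a = i}, ({b : B // f b = a.1} → ↥(MI f α i)) :=
  ⟨⟨(PFunctor.M.dest T.1).1, (MI_hered f α i T.1 T.2).1⟩,
    fun b => ⟨(PFunctor.M.dest T.1).2 b, (MI_hered f α i T.1 T.2).2 b⟩⟩

/-- Forgetting the restriction on labels. -/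
def forgetI (i : I) {X Y : Type} (g : X → Y)
    (z : Σ a : {a : A // α a = i}, ({b : B // f b = a.1} → X)) : (PolyPF f).Obj Y :=
  ⟨z.1.1, fun b => g (z.2 b)⟩

theorem forgetI_inj (i : I) {X Y : Type} (g : X → Y) (hg : Function.Injective g) :
    Function.Injective (forgetI f α i g) := by
  rintro ⟨⟨a, ha⟩, t⟩ ⟨⟨a', ha'⟩, t'⟩ h
  have h1 : a = a' := congrArg Sigma.fst h
  subst h1
  have h2 : (fun b => g (t b)) = fun b => g (t' b) := eq_of_heq (Sigma.mk.inj h).2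
  have : t = t' := funext fun b => hg (congrFun h2 b)
  rw [this]

theorem forgetI_MIstr (i : I) (T : ↥(MI f α i)) :
    forgetI f α i Subtype.val (MIstr f α i T) = PFunctor.M.dest T.1 := rfl

/-- The unfolding map into `M_f`. -/
def unfoldI (P : ICoalg f α) (i : I) : P.X i → (PolyPF f).M :=
  PFunctor.M.corec (fun x => forgetI f α i id (P.str i x))

theorem dest_unfoldI (P : ICoalg f α) (i : I) (x : P.X i) :
    PFunctor.M.dest (unfoldI f α P i x) = forgetI f α i (unfoldI f α P i) (P.str i x) :=
  PFunctor.M.dest_corec _ _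

theorem unfoldI_mem (P : ICoalg f α) (i : I) (x : P.X i) :
    unfoldI f α P i x ∈ MI f α i := by
  refine ⟨Set.range (unfoldI f α P i), ?_, x, rfl⟩
  rintro _ ⟨y, rfl⟩
  rw [dest_unfoldI]
  exact ⟨(P.str i y).1.2, fun b => ⟨_, rfl⟩⟩

/-- The terminal coalgebra. -/
def MIcoalg : ICoalg f α := ⟨fun i => ↥(MI f α i), MIstr f α⟩

/-- The morphism to the terminal coalgebra. -/
def MIlift (P : ICoalg f α) : ICoalg.Hom f α P (MIcoalg f α) where
  φ i x := ⟨unfoldI f α P i x, unfoldI_mem f α P i x⟩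
  comm i x := forgetI_inj f α i Subtype.val Subtype.val_injective
    (dest_unfoldI f α P i x)

theorem MIlift_unique (P : ICoalg f α) (m : ICoalg.Hom f α P (MIcoalg f α)) :
    m = MIlift f α P := by
  ext i x
  apply Subtype.ext
  have key : (fun x => (m.φ i x).1) = unfoldI f α P i := by
    apply PFunctor.M.corec_unique
    intro x
    exact congrArg (forgetI f α i Subtype.val) (m.comm i x)
  exact congrFun key x

/-- The family `i ↦ M^I i` of largest subsets of the terminal `P_f`-coalgebra `M_f`
hereditarily labelled in the fibre over `i`, with structure maps induced by `τ_f` (i.e.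
by `PFunctor.M.dest`), is a terminal object in the category of `P^I`-coalgebras: the
M-type of `f` in the slice over `I`. -/
theorem MI_is_terminal_indexed_coalgebra :
    ∃ γ : ∀ i : I, ↥(MI f α i) →
        Σ a : {a : A // α a = i}, ({b : B // f b = a.1} → ↥(MI f α i)),
      (∀ (i : I) (T : ↥(MI f α i)),
        ∃ h : ((γ i T).1.1 : A) = (PFunctor.M.dest T.1).1,
          ∀ (b : B) (hb : f b = (PFunctor.M.dest T.1).1),
            ((γ i T).2 ⟨b, hb.trans h.symm⟩).1 = (PFunctor.M.dest T.1).2 ⟨b, hb⟩) ∧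
      Nonempty (Limits.IsTerminal
        (⟨fun i => ↥(MI f α i), γ⟩ : ICoalg f α)) := by
  refine ⟨MIstr f α, fun i T => ⟨rfl, fun b hb => rfl⟩, ⟨?_⟩⟩
  exact Limits.IsTerminal.ofUniqueHom (Y := MIcoalg f α) (fun P => MIlift f α P)
    (fun P m => MIlift_unique f α P m)

end
end

section
/- Let C be a category with finite limits, G a comonad on C whose underlying endofunctor preserves finite limits, and (A, α) a G-coalgebra. Then there exist a comonad G' on the slice category C/A whose underlying endofunctor preserves finite limits, and an equivalence of categories between the slice of the Eilenberg–Moore category of G-coalgebras over (A, α) and the Eilenberg–Moore category of G'-coalgebras on C/A, which commutes up to natural isomorphism with the two forgetful functors to C/A (the one induced by the forgetful functor from G-coalgebras to C, and the forgetful functor from G'-coalgebras). The comonad G' is computed on an object t : X → A of C/A by pulling back G(t) : G X → G A along α : A → G A. -/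
open CategoryTheory CategoryTheory.Limits

namespace SliceComonad

set_option linter.unusedSectionVars false

section post

variable {C : Type u} [Category.{v} C] [HasFiniteLimits C]

theorem post_preserves (F : C ⥤ C) [PreservesFiniteLimits F] (A : C) :
    PreservesFiniteLimits (Over.post (X := A) F) := by
  have h1 : PreservesLimitsOfShape WalkingCospan (Over.post (X := A) F) := by
    have : PreservesLimitsOfShape WalkingCospan
        (Over.post (X := A) F ⋙ Over.forget (F.obj A)) := by
      change PreservesLimitsOfShape WalkingCospan (Over.forget A ⋙ F)
      infer_instance
    exact preservesLimitsOfShape_of_reflects_of_preserves _ (Over.forget (F.obj A))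
  have h2 : PreservesLimit (Functor.empty.{0} (Over A)) (Over.post (X := A) F) := by
    refine preservesTerminal_of_iso _ ?_
    refine (Over.post (X := A) F).mapIso
      (terminalIsTerminal.uniqueUpToIso Over.mkIdTerminal) ≪≫ ?_
    refine ?_ ≪≫ (terminalIsTerminal.uniqueUpToIso Over.mkIdTerminal).symm
    exact Over.isoMk (Iso.refl (F.obj A)) ((Category.id_comp _).trans (F.map_id A).symm)
  have h3 : PreservesLimitsOfShape (Discrete PEmpty.{1}) (Over.post (X := A) F) :=
    preservesLimitsOfShape_pempty_of_preservesTerminal _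
  exact preservesFiniteLimits_of_preservesTerminal_and_pullbacks _

end post

noncomputable section

variable {C : Type u} [Category.{v} C] [HasFiniteLimits C]
    (G : Comonad C) [PreservesFiniteLimits G.toFunctor]
    (K : Comonad.Coalgebra G)

abbrev P {X : C} (t : X ⟶ K.A) : C := pullback (G.map t) K.a
abbrev p1 {X : C} (t : X ⟶ K.A) : P G K t ⟶ G.obj X := pullback.fst _ _
abbrev p2 {X : C} (t : X ⟶ K.A) : P G K t ⟶ K.A := pullback.snd _ _

theorem cond {X : C} (t : X ⟶ K.A) : p1 G K t ≫ G.map t = p2 G K t ≫ K.a :=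
  pullback.condition

theorem sq {X : C} (t : X ⟶ K.A) : IsPullback (p1 G K t) (p2 G K t) (G.map t) K.a :=
  IsPullback.of_hasPullback _ _

theorem Gsq {X : C} (t : X ⟶ K.A) :
    IsPullback (G.map (p1 G K t)) (G.map (p2 G K t)) (G.map (G.map t)) (G.map K.a) :=
  (sq G K t).map G.toFunctor

/-- action on maps -/
def m {X Y : C} {t : X ⟶ K.A} {s : Y ⟶ K.A} (f : X ⟶ Y) (h : f ≫ s = t) :
    P G K t ⟶ P G K s :=
  pullback.lift (p1 G K t ≫ G.map f) (p2 G K t) (by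
    rw [Category.assoc, ← G.map_comp, h, cond])

theorem m_p1 {X Y : C} {t : X ⟶ K.A} {s : Y ⟶ K.A} (f : X ⟶ Y) (h : f ≫ s = t) :
    m G K f h ≫ p1 G K s = p1 G K t ≫ G.map f := pullback.lift_fst _ _ _

theorem m_p2 {X Y : C} {t : X ⟶ K.A} {s : Y ⟶ K.A} (f : X ⟶ Y) (h : f ≫ s = t) :
    m G K f h ≫ p2 G K s = p2 G K t := pullback.lift_snd _ _ _

/-- the coalgebra structure on the pullback -/
def st {X : C} (t : X ⟶ K.A) : P G K t ⟶ G.obj (P G K t) :=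
  (Gsq G K t).lift (p1 G K t ≫ G.δ.app X) (p2 G K t ≫ K.a) (by
    have := G.δ.naturality t
    dsimp at this
    rw [Category.assoc, Category.assoc, ← this, ← K.coassoc, ← Category.assoc, cond,
      Category.assoc])

theorem st_p1 {X : C} (t : X ⟶ K.A) :
    st G K t ≫ G.map (p1 G K t) = p1 G K t ≫ G.δ.app X := (Gsq G K t).lift_fst _ _ _

theorem st_p2 {X : C} (t : X ⟶ K.A) :
    st G K t ≫ G.map (p2 G K t) = p2 G K t ≫ K.a := (Gsq G K t).lift_snd _ _ _

def d {X : C} (t : X ⟶ K.A) : P G K t ⟶ P G K (p2 G K t) :=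
  pullback.lift (st G K t) (p2 G K t) (st_p2 G K t)

theorem d_p1 {X : C} (t : X ⟶ K.A) : d G K t ≫ p1 G K (p2 G K t) = st G K t :=
  pullback.lift_fst _ _ _

theorem d_p2 {X : C} (t : X ⟶ K.A) : d G K t ≫ p2 G K (p2 G K t) = p2 G K t :=
  pullback.lift_snd _ _ _

def e {X : C} (t : X ⟶ K.A) : P G K t ⟶ X := p1 G K t ≫ G.ε.app X

theorem e_w {X : C} (t : X ⟶ K.A) : e G K t ≫ t = p2 G K t := by
  have := G.ε.naturality t
  dsimp at this
  rw [e, Category.assoc, ← this, ← Category.assoc, cond, Category.assoc, K.counit,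
    Category.comp_id]

theorem P_ext {Z X : C} {t : X ⟶ K.A} {f g : Z ⟶ P G K t}
    (h1 : f ≫ p1 G K t = g ≫ p1 G K t) (h2 : f ≫ p2 G K t = g ≫ p2 G K t) : f = g :=
  pullback.hom_ext h1 h2

theorem GP_ext {Z X : C} {t : X ⟶ K.A} {f g : Z ⟶ G.obj (P G K t)}
    (h1 : f ≫ G.map (p1 G K t) = g ≫ G.map (p1 G K t))
    (h2 : f ≫ G.map (p2 G K t) = g ≫ G.map (p2 G K t)) : f = g :=
  (Gsq G K t).hom_ext h1 h2

theorem e_nat {X Y : C} {t : X ⟶ K.A} {s : Y ⟶ K.A} (f : X ⟶ Y) (h : f ≫ s = t) :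
    m G K f h ≫ e G K s = e G K t ≫ f := by
  have := G.ε.naturality f
  dsimp at this
  rw [e, e, reassoc_of% m_p1, this, Category.assoc]

theorem st_nat {X Y : C} {t : X ⟶ K.A} {s : Y ⟶ K.A} (f : X ⟶ Y) (h : f ≫ s = t) :
    m G K f h ≫ st G K s = st G K t ≫ G.map (m G K f h) := by
  have := G.δ.naturality f
  dsimp at this
  apply GP_ext
  · rw [Category.assoc, Category.assoc, st_p1, reassoc_of% m_p1, ← G.map_comp, m_p1, G.map_comp,
      reassoc_of% st_p1, this]
  · rw [Category.assoc, Category.assoc, st_p2, reassoc_of% m_p2, ← G.map_comp, m_p2, st_p2]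

theorem d_nat {X Y : C} {t : X ⟶ K.A} {s : Y ⟶ K.A} (f : X ⟶ Y) (h : f ≫ s = t) :
    m G K f h ≫ d G K s = d G K t ≫ m G K (m G K f h) (m_p2 G K f h) := by
  apply P_ext
  · rw [Category.assoc, Category.assoc, d_p1, m_p1, reassoc_of% d_p1, st_nat]
  · rw [Category.assoc, Category.assoc, d_p2, m_p2, m_p2, d_p2]

theorem st_e {X : C} (t : X ⟶ K.A) : st G K t ≫ G.map (e G K t) = p1 G K t := by
  rw [e, G.map_comp, reassoc_of% st_p1, G.right_counit, Category.comp_id]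

theorem st_counit {X : C} (t : X ⟶ K.A) : st G K t ≫ G.ε.app _ = 𝟙 _ := by
  have h1 := G.ε.naturality (p1 G K t)
  have h2 := G.ε.naturality (p2 G K t)
  dsimp at h1 h2
  apply P_ext
  · rw [Category.assoc, ← h1, reassoc_of% st_p1, G.left_counit, Category.comp_id, Category.id_comp]
  · rw [Category.assoc, ← h2, reassoc_of% st_p2, K.counit, Category.comp_id, Category.id_comp]

theorem st_coassoc {X : C} (t : X ⟶ K.A) :
    st G K t ≫ G.δ.app _ = st G K t ≫ G.map (st G K t) := by
  have h1 := G.δ.naturality (p1 G K t)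
  have h2 := G.δ.naturality (p2 G K t)
  dsimp at h1 h2
  apply ((Gsq G K t).map G.toFunctor).hom_ext
  · rw [Category.assoc, Category.assoc, ← h1, reassoc_of% st_p1, ← G.map_comp, st_p1, G.map_comp,
      reassoc_of% st_p1, G.coassoc]
  · rw [Category.assoc, Category.assoc, ← h2, reassoc_of% st_p2, ← G.map_comp, st_p2, G.map_comp,
      reassoc_of% st_p2, K.coassoc]

/-- the functor -/
def Fn : Over K.A ⥤ Over K.A where
  obj t := Over.mk (p2 G K t.hom)
  map {t s} f := Over.homMk (m G K f.left (Over.w f)) (m_p2 G K _ _)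
  map_id t := by
    apply Over.OverMorphism.ext
    change m G K (𝟙 t.left) (Category.id_comp t.hom) = 𝟙 (P G K t.hom)
    apply P_ext
    · rw [m_p1, G.map_id, Category.comp_id, Category.id_comp]
    · rw [m_p2, Category.id_comp]
  map_comp {r s t} f g := by
    apply Over.OverMorphism.ext
    have w : (f.left ≫ g.left) ≫ t.hom = r.hom := by
      rw [Category.assoc, Over.w g, Over.w f]
    change m G K (f.left ≫ g.left) w = m G K f.left (Over.w f) ≫ m G K g.left (Over.w g)
    apply P_ext
    · rw [m_p1, Category.assoc, m_p1, reassoc_of% m_p1, G.map_comp]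
    · rw [m_p2, Category.assoc, m_p2, m_p2]

/-- the comonad -/
def Cm : Comonad (Over K.A) where
  toFunctor := Fn G K
  ε :=
    { app := fun t => Over.homMk (U := (Fn G K).obj t) (V := t) (e G K t.hom) (e_w G K t.hom)
      naturality := fun t s f => by
        apply Over.OverMorphism.ext
        exact e_nat G K f.left (Over.w f) }
  δ :=
    { app := fun t => Over.homMk (U := (Fn G K).obj t) (V := (Fn G K).obj ((Fn G K).obj t))
        (d G K t.hom) (d_p2 G K t.hom)
      naturality := fun t s f => by
        apply Over.OverMorphism.ext
        exact d_nat G K f.left (Over.w f) }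
  coassoc t := by
    apply Over.OverMorphism.ext
    change d G K t.hom ≫ m G K (d G K t.hom) (d_p2 G K t.hom)
      = d G K t.hom ≫ d G K (p2 G K t.hom)
    apply P_ext
    · rw [Category.assoc, Category.assoc, m_p1, d_p1, reassoc_of% d_p1]
      apply GP_ext
      · rw [Category.assoc, Category.assoc, st_p1, ← G.map_comp, d_p1, reassoc_of% d_p1, st_coassoc]
      · rw [Category.assoc, Category.assoc, st_p2, ← G.map_comp, d_p2, reassoc_of% d_p2, st_p2]
    · rw [Category.assoc, Category.assoc, m_p2, d_p2, d_p2, d_p2]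
  left_counit t := by
    apply Over.OverMorphism.ext
    change d G K t.hom ≫ e G K (p2 G K t.hom) = 𝟙 (P G K t.hom)
    rw [e, reassoc_of% d_p1, st_counit]
  right_counit t := by
    apply Over.OverMorphism.ext
    change d G K t.hom ≫ m G K (e G K t.hom) (e_w G K t.hom) = 𝟙 (P G K t.hom)
    apply P_ext
    · rw [Category.assoc, m_p1, reassoc_of% d_p1, st_e, Category.id_comp]
    · rw [Category.assoc, m_p2, d_p2, Category.id_comp]

theorem Fn_preserves : PreservesFiniteLimits (Fn G K) := by
  have := post_preserves G.toFunctor K.A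
  have h : PreservesFiniteLimits (Over.post (X := K.A) G.toFunctor ⋙ Over.pullback K.a) :=
    comp_preservesFiniteLimits _ _
  refine preservesFiniteLimits_of_natIso
    (F := Over.post (X := K.A) G.toFunctor ⋙ Over.pullback K.a) (G := Fn G K) ?_
  refine NatIso.ofComponents (fun t => Iso.refl (Over.mk (p2 G K t.hom))) ?_
  intro t s f
  refine (Category.comp_id _).trans (Eq.trans ?_ (Category.id_comp _).symm)
  rfl

/-- from a coalgebra over `K`: structure map -/
def up {X : C} (t : X ⟶ K.A) (x : X ⟶ G.obj X) (h : x ≫ G.map t = t ≫ K.a) : X ⟶ P G K t :=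
  pullback.lift x t h

theorem up_p1 {X : C} (t : X ⟶ K.A) (x : X ⟶ G.obj X) (h : x ≫ G.map t = t ≫ K.a) :
    up G K t x h ≫ p1 G K t = x := pullback.lift_fst _ _ _

theorem up_p2 {X : C} (t : X ⟶ K.A) (x : X ⟶ G.obj X) (h : x ≫ G.map t = t ≫ K.a) :
    up G K t x h ≫ p2 G K t = t := pullback.lift_snd _ _ _

def EF : Over K ⥤ Comonad.Coalgebra (Cm G K) where
  obj T :=
    { A := Over.mk T.hom.f
      a := Over.homMk (U := Over.mk T.hom.f) (V := (Fn G K).obj (Over.mk T.hom.f))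
        (up G K T.hom.f T.left.a T.hom.h) (up_p2 G K _ _ _)
      counit := by
        apply Over.OverMorphism.ext
        change up G K T.hom.f T.left.a T.hom.h ≫ e G K T.hom.f = 𝟙 T.left.A
        rw [e, reassoc_of% up_p1, T.left.counit]
      coassoc := by
        apply Over.OverMorphism.ext
        change up G K T.hom.f T.left.a T.hom.h ≫ d G K T.hom.f =
          up G K T.hom.f T.left.a T.hom.h ≫ m G K (up G K T.hom.f T.left.a T.hom.h)
            (up_p2 G K _ _ _)
        apply P_ext
        · rw [Category.assoc, Category.assoc, d_p1, m_p1, reassoc_of% up_p1]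
          apply GP_ext
          · rw [Category.assoc, Category.assoc, st_p1, reassoc_of% up_p1, ← G.map_comp, up_p1,
              T.left.coassoc]
          · rw [Category.assoc, Category.assoc, st_p2, reassoc_of% up_p2, ← G.map_comp, up_p2]
            exact T.hom.h.symm
        · rw [Category.assoc, Category.assoc, d_p2, m_p2] }
  map {T S} f :=
    { f := Over.homMk (U := Over.mk T.hom.f) (V := Over.mk S.hom.f) f.left.f
        (congrArg Comonad.Coalgebra.Hom.f (Over.w f))
      h := by
        apply Over.OverMorphism.ext
        have w : f.left.f ≫ S.hom.f = T.hom.f := congrArg Comonad.Coalgebra.Hom.f (Over.w f)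
        change up G K T.hom.f T.left.a T.hom.h ≫ m G K f.left.f w
          = f.left.f ≫ up G K S.hom.f S.left.a S.hom.h
        apply P_ext
        · rw [Category.assoc, Category.assoc, m_p1, reassoc_of% up_p1, up_p1, f.left.h]
        · rw [Category.assoc, Category.assoc, m_p2, up_p2, up_p2, w] }
  map_id T := rfl
  map_comp f g := rfl

section inv
variable {G K}
variable (Z : Comonad.Coalgebra (Cm G K))

/-- structure map, untyped from the slice -/
def zs : Z.A.left ⟶ P G K Z.A.hom := Z.a.left

theorem zs_p2 : zs Z ≫ p2 G K Z.A.hom = Z.A.hom := Over.w Z.a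

theorem zs_e : zs Z ≫ e G K Z.A.hom = 𝟙 _ := congrArg CommaMorphism.left Z.counit

theorem zs_d : zs Z ≫ d G K Z.A.hom = zs Z ≫ m G K (zs Z) (zs_p2 Z) :=
  congrArg CommaMorphism.left Z.coassoc

def inv0 : Comonad.Coalgebra G where
  A := Z.A.left
  a := zs Z ≫ p1 G K Z.A.hom
  counit := by
    have := zs_e Z
    rwa [e, ← Category.assoc] at this
  coassoc := by
    have h := zs_d Z =≫ (p1 G K (p2 G K Z.A.hom) ≫ G.map (p1 G K Z.A.hom))
    rw [Category.assoc, Category.assoc, reassoc_of% d_p1, reassoc_of% m_p1, st_p1, ← G.map_comp] at h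
    rw [Category.assoc, Category.assoc, h]

theorem zs_w : (zs Z ≫ p1 G K Z.A.hom) ≫ G.map Z.A.hom = Z.A.hom ≫ K.a := by
  rw [Category.assoc, cond, reassoc_of% zs_p2]

def inv1 : inv0 Z ⟶ K where
  f := Z.A.hom
  h := zs_w Z

def inv2 : (EF G K).obj (Over.mk (inv1 Z)) ≅ Z :=
  Comonad.Coalgebra.isoMk (Iso.refl Z.A) (by
    refine (congrArg _ ((Cm G K).map_id _)).trans ?_
    refine (Category.comp_id _).trans (Eq.trans ?_ (Category.id_comp _).symm)
    apply Over.OverMorphism.ext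
    change up G K Z.A.hom (zs Z ≫ p1 G K Z.A.hom) (zs_w Z) = zs Z
    apply P_ext
    · rw [up_p1]
    · rw [up_p2, zs_p2])

end inv

instance : (EF G K).Faithful where
  map_injective {T S} f g h := by
    apply Over.OverMorphism.ext
    apply Comonad.Coalgebra.Hom.ext
    exact congrArg (fun k => CommaMorphism.left (Comonad.Coalgebra.Hom.f k)) h

instance : (EF G K).Full where
  map_surjective {T S} f := by
    let f0 : T.left.A ⟶ S.left.A := f.f.left
    have w : f0 ≫ S.hom.f = T.hom.f := Over.w f.f
    have h : up G K T.hom.f T.left.a T.hom.h ≫ m G K f0 w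
          = f0 ≫ up G K S.hom.f S.left.a S.hom.h := congrArg CommaMorphism.left f.h
    have h' := h =≫ p1 G K S.hom.f
    rw [Category.assoc, Category.assoc, m_p1, reassoc_of% up_p1, up_p1] at h'
    let f1 : T.left ⟶ S.left := { f := f0, h := h' }
    refine ⟨Over.homMk f1 ?_, ?_⟩
    · apply Comonad.Coalgebra.Hom.ext
      exact w
    · rfl

instance : (EF G K).EssSurj where
  mem_essImage Z := ⟨_, ⟨inv2 Z⟩⟩

instance : (EF G K).IsEquivalence where

end

end SliceComonad

/-- For a cartesian comonad `G` on a category `C` with finite limits and a `G`-coalgebra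
`(A, α)`, there is a cartesian comonad `G'` on the slice `C/A` — computed on `t : X → A`
by pulling back `G t : G X → G A` along `α : A → G A` — together with an equivalence
between the slice of the category of `G`-coalgebras over `(A, α)` and the category of
`G'`-coalgebras, commuting up to natural isomorphism with the two forgetful functors
to `C/A`. -/
theorem slice_comonad_coalgebra_equivalence
    {C : Type u} [Category.{v} C] [HasFiniteLimits C]
    (G : Comonad C) [PreservesFiniteLimits G.toFunctor]
    (Aα : Comonad.Coalgebra G) :
    ∃ G' : Comonad (Over Aα.A),
      PreservesFiniteLimits G'.toFunctor ∧
      (∀ t : Over Aα.A,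
        ∃ π : (G'.toFunctor.obj t).left ⟶ G.toFunctor.obj t.left,
          IsPullback π (G'.toFunctor.obj t).hom (G.toFunctor.map t.hom) Aα.a) ∧
      ∃ E : Over Aα ≌ Comonad.Coalgebra G',
        Nonempty (E.functor ⋙ Comonad.forget G' ≅ Over.post (Comonad.forget G)) := by
  refine ⟨SliceComonad.Cm G Aα, SliceComonad.Fn_preserves G Aα, fun t =>
    ⟨SliceComonad.p1 G Aα t.hom, SliceComonad.sq G Aα t.hom⟩,
    (SliceComonad.EF G Aα).asEquivalence, ⟨Iso.refl _⟩⟩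
end

section
/- Let f : B → A be a function between types, let (X, γ) and (Y, δ) be P_f-coalgebras and α : X → Y a morphism of P_f-coalgebras. Given a path ⟨y₀, b₀, y₁, b₁, …, y_n⟩ in (Y, δ) and an element x₀ ∈ X with α(x₀) = y₀, there exists a unique path ⟨x₀, b₀, x₁, b₁, …, x_n⟩ in (X, γ) with the same elements b_i of B and starting at x₀ whose image under α is the given path, i.e. α(x_i) = y_i for all i ≤ n. -/
/-- A (finite) path `⟨x₀, b₀, x₁, b₁, …, xₙ⟩` in a `P_f`-coalgebra `(X, γ)`: writing
`γ (xᵢ) = (aᵢ, tᵢ)`, we require `f bᵢ = aᵢ` and `x_{i+1} = tᵢ bᵢ` for all `i < n`. -/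
def IsPath {B A X : Type} (f : B → A) (γ : X → Σ a : A, {b : B // f b = a} → X)
    {n : ℕ} (x : Fin (n + 1) → X) (b : Fin n → B) : Prop :=
  ∀ i : Fin n, ∃ h : f (b i) = (γ (x i.castSucc)).1,
    x i.succ = (γ (x i.castSucc)).2 ⟨b i, h⟩

/-- Paths lift uniquely along coalgebra morphisms: if `α : (X, γ) → (Y, δ)` is a morphism
of `P_f`-coalgebras, `⟨y₀, b₀, …, yₙ⟩` is a path in `(Y, δ)` and `α x₀ = y₀`, then there
is a unique path in `(X, γ)` with the same `bᵢ`'s starting at `x₀` whose image under `α`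
is the given path. -/
theorem path_lifting {B A X Y : Type} (f : B → A)
    (γ : X → Σ a : A, {b : B // f b = a} → X)
    (δ : Y → Σ a : A, {b : B // f b = a} → Y)
    (α : X → Y)
    (hα : ∀ x : X, δ (α x) = ⟨(γ x).1, fun b => α ((γ x).2 b)⟩)
    {n : ℕ} (y : Fin (n + 1) → Y) (b : Fin n → B) (hy : IsPath f δ y b)
    (x₀ : X) (hx₀ : α x₀ = y 0) :
    ∃! x : Fin (n + 1) → X,
      x 0 = x₀ ∧ IsPath f γ x b ∧ ∀ i : Fin (n + 1), α (x i) = y i := by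
  have step : ∀ (x : X) (y' : Y) (c : B),
      (∃ h : f c = (δ (α x)).1, y' = (δ (α x)).2 ⟨c, h⟩) →
      ∃ h : f c = (γ x).1, y' = α ((γ x).2 ⟨c, h⟩) := by
    intro x y' c h
    rw [hα] at h
    exact h
  apply existsUnique_of_exists_of_unique
  · induction n generalizing x₀ with
    | zero =>
      refine ⟨fun _ => x₀, rfl, fun i => i.elim0, fun i => ?_⟩
      rw [Fin.fin_one_eq_zero i]
      exact hx₀
    | succ n ih =>
      have h0 := hy 0
      rw [Fin.castSucc_zero, ← hx₀] at h0
      obtain ⟨h, e⟩ := step _ _ _ h0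
      obtain ⟨x, hx0, hp, hx⟩ := ih (fun i => y i.succ) (fun i => b i.succ)
        (fun i => hy i.succ) ((γ x₀).2 ⟨b 0, h⟩) e.symm
      refine ⟨Fin.cons x₀ x, rfl, ?_, ?_⟩
      · intro i
        refine Fin.cases ?_ (fun j => ?_) i
        · exact ⟨h, hx0⟩
        · exact hp j
      · intro i
        refine Fin.cases ?_ (fun j => ?_) i
        · exact hx₀
        · exact hx j
  · rintro u v ⟨hu0, hu, -⟩ ⟨hv0, hv, -⟩
    funext i
    induction i using Fin.induction with
    | zero => rw [hu0, hv0]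
    | succ i ih =>
      obtain ⟨h, e⟩ := hu i
      have hvi := hv i
      rw [← ih] at hvi
      obtain ⟨h', e'⟩ := hvi
      rw [e, e']
end
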